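/- arXiv:1907.04599 — 5 statements merged into one kernel-verified Lean document; each statement's English description precedes it below -/
import Mathlib

section
/- Let η be an integer with η > 1, let β ∈ (0,1], and let Q0, A0, Q1, A1 be positive integers. For integers q0, q1 define B̃(q0,q1) := {(g0,g1) ∈ (1,η] × (1,η] : |A1·g1·q1 + A0·g0·q0| < β}, and let B̃ be the union of the sets B̃(q0,q1) over all integer pairs (q0,q1) ≠ (0,0) with |q0| ≤ Q0 and |q1| ≤ Q1. Then the Lebesgue measure of B̃ in ℝ² satisfies L(B̃) ≤ 8·β·(η−1)·min{Q0·Q1/A1, Q1·Q0/A0, Q0·η/A1, Q1·η/A0}. -/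
open MeasureTheory Set

/-- The set of `y ∈ (1, η]` for which some positive integer multiple `b ≤ Q` of `B * y` is within `β`
of `x` has measure at most `4 β min(Q, η) / B`. -/
theorem volume_near_multiple_le (η : ℤ) (hη : 1 < η) (β : ℝ) (hβ : β ∈ Set.Ioc (0 : ℝ) 1)
    (Q B : ℤ) (hQ : 0 < Q) (hB : 0 < B) (x : ℝ) :
    volume {y : ℝ | y ∈ Set.Ioc (1 : ℝ) η ∧ ∃ b ∈ Finset.Icc 1 Q, |(B : ℝ) * y * b - x| < β} ≤
      ENNReal.ofReal (4 * β * min (Q : ℝ) η / B) := by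
  classical
  obtain ⟨hβ0, hβ1⟩ := hβ
  have hB' : (1 : ℝ) ≤ B := by exact_mod_cast hB
  have hη' : (2 : ℝ) ≤ η := by exact_mod_cast hη
  have hQ' : (1 : ℝ) ≤ Q := by exact_mod_cast hQ
  set F := (Finset.Icc 1 Q).filter
    fun b : ℤ => ∃ y ∈ Set.Ioc (1 : ℝ) η, |(B : ℝ) * y * b - x| < β with hF
  have hsub : {y : ℝ | y ∈ Set.Ioc (1 : ℝ) η ∧
      ∃ b ∈ Finset.Icc 1 Q, |(B : ℝ) * y * b - x| < β} ⊆
      ⋃ b ∈ F, Set.Ioo ((x - β) / (B * b)) ((x + β) / (B * b)) := by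
    rintro y ⟨hy, b, hb, h⟩
    have hb1 : (1 : ℝ) ≤ b := by exact_mod_cast (Finset.mem_Icc.1 hb).1
    have hpos : (0 : ℝ) < B * b := by positivity
    refine Set.mem_iUnion₂.2 ⟨b, Finset.mem_filter.2 ⟨hb, y, hy, h⟩, ?_⟩
    rw [abs_lt] at h
    constructor
    · rw [div_lt_iff₀ hpos]; linarith
    · rw [lt_div_iff₀ hpos]; linarith
  refine (measure_mono hsub).trans ((measure_biUnion_finset_le _ _).trans ?_)
  rcases F.eq_empty_or_nonempty with h0 | hne
  · simp [h0]
  set m := F.min' hne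
  set M := F.max' hne
  have hm := Finset.mem_filter.1 (F.min'_mem hne)
  have hM := Finset.mem_filter.1 (F.max'_mem hne)
  change m ∈ _ ∧ _ at hm
  change M ∈ _ ∧ _ at hM
  have hm1 : (1 : ℝ) ≤ m := by exact_mod_cast (Finset.mem_Icc.1 hm.1).1
  have hM1 : (1 : ℝ) ≤ M := by exact_mod_cast (Finset.mem_Icc.1 hM.1).1
  have hMQ : (M : ℝ) ≤ Q := by exact_mod_cast (Finset.mem_Icc.1 hM.1).2
  have hcard : (F.card : ℝ) ≤ M := by
    have hs : F ⊆ Finset.Icc 1 M := fun b hb => Finset.mem_Icc.2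
      ⟨(Finset.mem_Icc.1 (Finset.mem_filter.1 hb).1).1, F.le_max' b hb⟩
    have h := Finset.card_le_card hs
    have hM0 : 1 ≤ M := (Finset.mem_Icc.1 hM.1).1
    rw [Int.card_Icc] at h
    have : (F.card : ℤ) ≤ M := by omega
    exact_mod_cast this
  have hMm : (M : ℝ) ≤ 2 * η * m := by
    obtain ⟨y, hy, hyM⟩ := hM.2
    obtain ⟨z, hz, hzm⟩ := hm.2
    rw [abs_lt] at hyM hzm
    have h1 : (B : ℝ) * M ≤ B * y * M := by
      have : (0 : ℝ) ≤ B * M := by positivity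
      nlinarith [hy.1]
    have h2 : (B : ℝ) * z * m ≤ B * (η * m) := by
      have : (0 : ℝ) ≤ B * m := by positivity
      nlinarith [hz.2]
    have h3 : (B : ℝ) * M < B * (η * m + 2) := by nlinarith
    have h4 : (M : ℝ) < η * m + 2 := lt_of_mul_lt_mul_left h3 (by positivity)
    nlinarith
  have hterm : ∀ b ∈ F, volume (Set.Ioo ((x - β) / ((B : ℝ) * b)) ((x + β) / (B * b))) ≤
      ENNReal.ofReal (2 * β / (B * m)) := by
    intro b hb
    have hmb : (m : ℝ) ≤ b := by exact_mod_cast F.min'_le b hb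
    rw [Real.volume_Ioo, ← sub_div]
    refine ENNReal.ofReal_le_ofReal ?_
    rw [show x + β - (x - β) = 2 * β by ring]
    gcongr
  refine (Finset.sum_le_card_nsmul _ _ _ hterm).trans ?_
  rw [← ENNReal.ofReal_nsmul]
  refine ENNReal.ofReal_le_ofReal ?_
  have hratio : (F.card : ℝ) ≤ 2 * min (Q : ℝ) η * m := by
    rcases min_cases (Q : ℝ) η with ⟨h, -⟩ | ⟨h, -⟩ <;> rw [h]
    · nlinarith
    · exact hcard.trans hMm
  rw [nsmul_eq_mul, ← mul_div_assoc, div_le_div_iff₀ (by positivity) (by positivity)]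
  have : 0 ≤ 2 * β * B := by positivity
  nlinarith [mul_le_mul_of_nonneg_left hratio this]

/-- The gain pairs in `(1, η]²` at which a positive integer combination of the first gain and one
of the second are within `β` of each other. -/
def nearCoincidence (η : ℤ) (β : ℝ) (P A Q B : ℤ) : Set (ℝ × ℝ) :=
  {p | p.1 ∈ Set.Ioc (1 : ℝ) η ∧ p.2 ∈ Set.Ioc (1 : ℝ) η ∧
    ∃ a ∈ Finset.Icc 1 P, ∃ b ∈ Finset.Icc 1 Q, |(B : ℝ) * p.2 * b - A * p.1 * a| < β}

theorem volume_nearCoincidence_le (η : ℤ) (hη : 1 < η) (β : ℝ) (hβ : β ∈ Set.Ioc (0 : ℝ) 1)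
    (P A Q B : ℤ) (hP : 0 < P) (hQ : 0 < Q) (hB : 0 < B) :
    volume (nearCoincidence η β P A Q B) ≤
      ENNReal.ofReal (4 * β * ((η : ℝ) - 1) * (P * min (Q : ℝ) η / B)) := by
  have hη' : (1 : ℝ) < η := by exact_mod_cast hη
  set C := 4 * β * min (Q : ℝ) η / B with hC
  set S : ℤ → Set (ℝ × ℝ) := fun a => {p | p.1 ∈ Set.Ioc (1 : ℝ) η ∧ p.2 ∈ Set.Ioc (1 : ℝ) η ∧
    ∃ b ∈ Finset.Icc 1 Q, |(B : ℝ) * p.2 * b - A * p.1 * a| < β} with hS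
  have hsub : nearCoincidence η β P A Q B ⊆ ⋃ a ∈ Finset.Icc 1 P, S a := by
    rintro p ⟨h1, h2, a, ha, h⟩
    exact Set.mem_iUnion₂.2 ⟨a, ha, h1, h2, h⟩
  have hstrip : ∀ a ∈ Finset.Icc 1 P, volume (S a) ≤ ENNReal.ofReal ((η - 1) * C) := by
    intro a _
    have hSa : S a = (Prod.fst ⁻¹' Set.Ioc (1 : ℝ) η ∩ Prod.snd ⁻¹' Set.Ioc (1 : ℝ) η) ∩
        ⋃ b ∈ Finset.Icc 1 Q, {p : ℝ × ℝ | |(B : ℝ) * p.2 * b - A * p.1 * a| < β} := by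
      ext p; simp [hS, and_assoc]
    have hmeas : MeasurableSet (S a) := by
      rw [hSa]
      refine ((measurable_fst measurableSet_Ioc).inter (measurable_snd measurableSet_Ioc)).inter
        (Finset.measurableSet_biUnion _ fun b _ => ?_)
      exact measurableSet_lt (by fun_prop) measurable_const
    rw [Measure.volume_eq_prod, Measure.prod_apply hmeas]
    calc ∫⁻ x, volume (Prod.mk x ⁻¹' S a)
        ≤ ∫⁻ x, (Set.Ioc (1 : ℝ) η).indicator (fun _ => ENNReal.ofReal C) x := by
          refine lintegral_mono fun x => ?_
          by_cases hx : x ∈ Set.Ioc (1 : ℝ) η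
          · rw [Set.indicator_of_mem hx]
            refine (measure_mono ?_).trans
              (volume_near_multiple_le η hη β hβ Q B hQ hB (A * x * a))
            exact fun y hy => hy.2
          · rw [Set.indicator_of_notMem hx]
            have : Prod.mk x ⁻¹' S a = ∅ :=
              Set.eq_empty_of_forall_notMem fun y hy => hx hy.1
            simp [this]
      _ = ENNReal.ofReal ((η - 1) * C) := by
          rw [lintegral_indicator_const measurableSet_Ioc, Real.volume_Ioc, mul_comm,
            ENNReal.ofReal_mul (by linarith)]
  refine (measure_mono hsub).trans ((measure_biUnion_finset_le _ _).trans
    ((Finset.sum_le_card_nsmul _ _ _ hstrip).trans ?_))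
  rw [← ENNReal.ofReal_nsmul, Int.card_Icc, nsmul_eq_mul]
  refine ENNReal.ofReal_le_ofReal (le_of_eq ?_)
  have : (((P + 1 - 1).toNat : ℕ) : ℝ) = P := by
    have h : (((P + 1 - 1).toNat : ℕ) : ℤ) = P := by omega
    exact_mod_cast h
  rw [this, hC]
  ring

theorem volume_nearCoincidence_swap_le (η : ℤ) (β : ℝ) (P A Q B : ℤ) :
    volume (nearCoincidence η β P A Q B) ≤ volume (nearCoincidence η β Q B P A) := by
  have h : volume (MeasurableEquiv.prodComm ⁻¹' nearCoincidence η β Q B P A) =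
      volume (nearCoincidence η β Q B P A) :=
    (Measure.measurePreserving_swap (μ := (volume : Measure ℝ))
      (ν := (volume : Measure ℝ))).measure_preimage_equiv (f := MeasurableEquiv.prodComm) _
  rw [← h]
  refine measure_mono ?_
  rintro p ⟨h1, h2, a, ha, b, hb, hab⟩
  exact ⟨h2, h1, b, hb, a, ha, by rwa [abs_sub_comm] at hab⟩

/-- A combination of two reals larger than `1` with integer coefficients that is less than `1` in
absolute value has coefficients of opposite signs. -/
theorem opposite_signs_of_abs_lt_one {x y : ℝ} (hx : 1 < x) (hy : 1 < y) {a b : ℤ}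
    (hab : (a, b) ≠ (0, 0)) (h : |y * b + x * a| < 1) : 0 < a ∧ b < 0 ∨ a < 0 ∧ 0 < b := by
  rw [abs_lt] at h
  have hpos : ∀ c d : ℤ, 0 ≤ c → 0 ≤ d → (c, d) ≠ (0, 0) → 1 ≤ y * (d : ℝ) + x * c := by
    intro c d hc hd hcd
    have hsum : 1 ≤ c + d := by
      by_contra hlt
      exact hcd (by ext <;> simp <;> omega)
    have hsum' : (1 : ℝ) ≤ c + d := by exact_mod_cast hsum
    have hc' : (0 : ℝ) ≤ c := by exact_mod_cast hc
    have hd' : (0 : ℝ) ≤ d := by exact_mod_cast hd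
    nlinarith
  rcases le_or_gt 0 a with ha | ha <;> rcases le_or_gt 0 b with hb | hb
  · linarith [hpos a b ha hb hab]
  · rcases ha.eq_or_lt with rfl | ha
    · have := hpos 0 (-b) le_rfl (by omega) (by simp; omega)
      push_cast at this h
      linarith
    · exact Or.inl ⟨ha, hb⟩
  · rcases hb.eq_or_lt with rfl | hb
    · have := hpos (-a) 0 (by omega) le_rfl (by simp; omega)
      push_cast at this h
      linarith
    · exact Or.inr ⟨ha, hb⟩
  · have := hpos (-a) (-b) (by omega) (by omega) (by simp; omega)
    push_cast at this
    linarith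

/-- measure bound for the outage set of gain pairs (g0, g1) ∈ (1,η]²
on which some integer combination |A1·g1·q1 + A0·g0·q0| is smaller than β. -/
theorem outage_measure_two_signals
    (η : ℤ) (hη : 1 < η) (β : ℝ) (hβ : β ∈ Set.Ioc (0 : ℝ) 1)
    (Q0 A0 Q1 A1 : ℤ) (hQ0 : 0 < Q0) (hA0 : 0 < A0) (hQ1 : 0 < Q1) (hA1 : 0 < A1) :
    volume {p : ℝ × ℝ | ∃ q0 q1 : ℤ, (q0, q1) ≠ (0, 0) ∧ |q0| ≤ Q0 ∧ |q1| ≤ Q1 ∧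
        p.1 ∈ Set.Ioc (1 : ℝ) (η : ℝ) ∧ p.2 ∈ Set.Ioc (1 : ℝ) (η : ℝ) ∧
        |(A1 : ℝ) * p.2 * (q1 : ℝ) + (A0 : ℝ) * p.1 * (q0 : ℝ)| < β} ≤
      ENNReal.ofReal (8 * β * ((η : ℝ) - 1) *
        min (min ((Q0 : ℝ) * (Q1 : ℝ) / (A1 : ℝ)) ((Q1 : ℝ) * (Q0 : ℝ) / (A0 : ℝ)))
            (min ((Q0 : ℝ) * (η : ℝ) / (A1 : ℝ)) ((Q1 : ℝ) * (η : ℝ) / (A0 : ℝ)))) := by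
  have hη' : (1 : ℝ) < η := by exact_mod_cast hη
  have hA0' : (1 : ℝ) ≤ A0 := by exact_mod_cast hA0
  have hA1' : (1 : ℝ) ≤ A1 := by exact_mod_cast hA1
  have hQ0' : (1 : ℝ) ≤ Q0 := by exact_mod_cast hQ0
  have hQ1' : (1 : ℝ) ≤ Q1 := by exact_mod_cast hQ1
  have hβ0 := hβ.1
  have hη1 : 0 < (η : ℝ) - 1 := by linarith
  have hsub : {p : ℝ × ℝ | ∃ q0 q1 : ℤ, (q0, q1) ≠ (0, 0) ∧ |q0| ≤ Q0 ∧ |q1| ≤ Q1 ∧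
        p.1 ∈ Set.Ioc (1 : ℝ) (η : ℝ) ∧ p.2 ∈ Set.Ioc (1 : ℝ) (η : ℝ) ∧
        |(A1 : ℝ) * p.2 * (q1 : ℝ) + (A0 : ℝ) * p.1 * (q0 : ℝ)| < β} ⊆
      nearCoincidence η β Q0 A0 Q1 A1 := by
    rintro p ⟨q0, q1, hne, h0, h1, hp1, hp2, h⟩
    rw [abs_le] at h0 h1
    have hx : 1 < (A0 : ℝ) * p.1 := by nlinarith [hp1.1]
    have hy : 1 < (A1 : ℝ) * p.2 := by nlinarith [hp2.1]
    refine ⟨hp1, hp2, ?_⟩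
    rcases opposite_signs_of_abs_lt_one hx hy hne (h.trans_le hβ.2) with ⟨ha, hb⟩ | ⟨ha, hb⟩
    · refine ⟨q0, Finset.mem_Icc.2 (by omega), -q1, Finset.mem_Icc.2 (by omega), ?_⟩
      rw [← abs_neg] at h
      push_cast
      convert h using 2
      ring
    · refine ⟨-q0, Finset.mem_Icc.2 (by omega), q1, Finset.mem_Icc.2 (by omega), ?_⟩
      push_cast
      convert h using 2
      ring
  have hdouble : ∀ P Q B : ℝ, 0 < P → 0 < Q → 0 < B → ∀ c, min Q η ≤ c →
      4 * β * ((η : ℝ) - 1) * (P * min Q η / B) ≤ 8 * β * ((η : ℝ) - 1) * (P * c / B) := by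
    intro P Q B hP hQ hB c hc
    have hc0 : 0 < c := (lt_min hQ (by linarith)).trans_le hc
    gcongr
    norm_num
  have hfst := (measure_mono hsub).trans
    (volume_nearCoincidence_le η hη β hβ Q0 A0 Q1 A1 hQ0 hQ1 hA1)
  have hsnd := ((measure_mono hsub).trans (volume_nearCoincidence_swap_le η β Q0 A0 Q1 A1)).trans
    (volume_nearCoincidence_le η hη β hβ Q1 A1 Q0 A0 hQ1 hQ0 hA0)
  have hfst' := fun c hc => hfst.trans (ENNReal.ofReal_le_ofReal
    (hdouble Q0 Q1 A1 (by linarith) (by linarith) (by linarith) c hc))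
  have hsnd' := fun c hc => hsnd.trans (ENNReal.ofReal_le_ofReal
    (hdouble Q1 Q0 A0 (by linarith) (by linarith) (by linarith) c hc))
  refine min_rec' (fun t => volume _ ≤ ENNReal.ofReal (8 * β * ((η : ℝ) - 1) * t)) ?_ ?_
  · exact min_rec' (fun t => volume _ ≤ ENNReal.ofReal (8 * β * ((η : ℝ) - 1) * t))
      (hfst' _ (min_le_left _ _)) (hsnd' _ (min_le_left _ _))
  · exact min_rec' (fun t => volume _ ≤ ENNReal.ofReal (8 * β * ((η : ℝ) - 1) * t))
      (hfst' _ (min_le_right _ _)) (hsnd' _ (min_le_right _ _))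
end

section
/- Let α ∈ [2/3, 1), let ε ∈ (0, α/2), let κ ∈ (0,1], and let P ≥ 1 be a real number. Set Q_max := P^{(α/2−ε)/2}. Then the Lebesgue measure in ℝ⁴ of the set of quadruples (h11,h12,h21,h22) ∈ (1,2]⁴ for which there exist integers q0, q0' with |q0|, |q0'| ≤ Q_max and integers q1, q1' with |q1|, |q1'| ≤ 2·Q_max such that (q0,q1) ≠ (q0',q1') and |P^{(1−α)/2}·h11·(q0−q0') + h12·(q1−q1')| < κ·P^{−(3α/2−1)/2} is at most 64·κ·P^{−ε/2}. -/
open MeasureTheory Set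

/-- The part of the cube `(1,2]⁴` within `δ` of the hyperplane `c h₁ = d h₂` has measure at most
`2δ/c`. -/
lemma volume_cube_slab_le (c d δ : ℝ) (hc : 0 < c) :
    volume {h : ℝ × ℝ × ℝ × ℝ |
        h.2 ∈ Ioc (1 : ℝ) 2 ×ˢ Ioc (1 : ℝ) 2 ×ˢ Ioc (1 : ℝ) 2 ∧ |c * h.1 - d * h.2.1| < δ} ≤
      ENNReal.ofReal (2 * δ / c) := by
  have hT : MeasurableSet (Ioc (1 : ℝ) 2 ×ˢ Ioc (1 : ℝ) 2 ×ˢ Ioc (1 : ℝ) 2) := by measurability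
  have hS : MeasurableSet {h : ℝ × ℝ × ℝ × ℝ |
      h.2 ∈ Ioc (1 : ℝ) 2 ×ˢ Ioc (1 : ℝ) 2 ×ˢ Ioc (1 : ℝ) 2 ∧ |c * h.1 - d * h.2.1| < δ} :=
    (measurable_snd hT).inter (measurableSet_lt
      (Continuous.measurable (f := fun h : ℝ × ℝ × ℝ × ℝ => |c * h.1 - d * h.2.1|) (by fun_prop))
      measurable_const)
  have hvol : volume (Ioc (1 : ℝ) 2 ×ˢ Ioc (1 : ℝ) 2 ×ˢ Ioc (1 : ℝ) 2) = 1 := by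
    simp only [Measure.volume_eq_prod, Measure.prod_prod, Real.volume_Ioc]
    norm_num
  rw [Measure.volume_eq_prod, Measure.prod_apply_symm hS]
  calc _ ≤ ∫⁻ y, (Ioc (1 : ℝ) 2 ×ˢ Ioc (1 : ℝ) 2 ×ˢ Ioc (1 : ℝ) 2).indicator
        (fun _ => ENNReal.ofReal (2 * δ / c)) y := by
        refine lintegral_mono fun y => ?_
        by_cases hy : y ∈ Ioc (1 : ℝ) 2 ×ˢ Ioc (1 : ℝ) 2 ×ˢ Ioc (1 : ℝ) 2
        · rw [indicator_of_mem hy]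
          calc _ ≤ volume (Ioo ((d * y.1 - δ) / c) ((d * y.1 + δ) / c)) := by
                refine measure_mono fun x hx => ?_
                have hx' := abs_lt.1 hx.2
                simp only at hx'
                rw [mem_Ioo, div_lt_iff₀ hc, lt_div_iff₀ hc]
                constructor <;> linarith
            _ = _ := by
                rw [Real.volume_Ioo]
                congr 1
                ring
        · rw [indicator_of_notMem hy]
          refine le_of_eq (measure_mono_null (t := ∅) (fun x hx => hy hx.1) measure_empty)
    _ = ENNReal.ofReal (2 * δ / c) := by
        rw [lintegral_indicator hT, setLIntegral_const, hvol, mul_one]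

/-- If an integer combination of two reals exceeding `1` is smaller than `1` in absolute value,
its coefficients are nonzero and of opposite signs. -/
lemma natAbs_pos_and_abs_sub_natAbs_eq {x y : ℝ} (hx : 1 < x) (hy : 1 < y) {a b : ℤ}
    (hab : a ≠ 0 ∨ b ≠ 0) (h : |x * a + y * b| < 1) :
    0 < a.natAbs ∧ 0 < b.natAbs ∧ |x * a.natAbs - y * b.natAbs| = |x * a + y * b| := by
  have key : (0 < a ∧ b < 0) ∨ (a < 0 ∧ 0 < b) := by
    obtain ⟨h1, h2⟩ := abs_lt.1 h
    by_contra hcon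
    have hcase : (0 ≤ a ∧ 0 ≤ b ∧ 1 ≤ a + b) ∨ (a ≤ 0 ∧ b ≤ 0 ∧ a + b ≤ -1) := by omega
    rcases hcase with ⟨ha, hb, hs⟩ | ⟨ha, hb, hs⟩
    · have ha' : (0 : ℝ) ≤ a := by exact_mod_cast ha
      have hb' : (0 : ℝ) ≤ b := by exact_mod_cast hb
      have hs' : (1 : ℝ) ≤ a + b := by exact_mod_cast hs
      nlinarith
    · have ha' : (a : ℝ) ≤ 0 := by exact_mod_cast ha
      have hb' : (b : ℝ) ≤ 0 := by exact_mod_cast hb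
      have hs' : (a : ℝ) + b ≤ -1 := by exact_mod_cast hs
      nlinarith
  refine ⟨by omega, by omega, ?_⟩
  rw [Nat.cast_natAbs, Nat.cast_natAbs, Int.cast_abs, Int.cast_abs]
  rcases key with ⟨ha, hb⟩ | ⟨ha, hb⟩
  · rw [abs_of_pos (by exact_mod_cast ha : (0 : ℝ) < a),
      abs_of_neg (by exact_mod_cast hb : (b : ℝ) < 0)]
    congr 1
    ring
  · rw [abs_of_neg (by exact_mod_cast ha : (a : ℝ) < 0),
      abs_of_pos (by exact_mod_cast hb : (0 : ℝ) < b), ← abs_neg]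
    congr 1
    ring

/-- for the interference-channel scheme with 2/3 ≤ α < 1, the set of
channel coefficients (h11,h12,h21,h22) ∈ (1,2]⁴ on which the minimum constellation
distance falls below κ·P^{−(3α/2−1)/2} has Lebesgue measure at most 64·κ·P^{−ε/2}. -/
theorem ic_min_distance_outage_measure
    (α ε κ P : ℝ) (hα : α ∈ Set.Ico (2/3 : ℝ) 1) (hε : ε ∈ Set.Ioo (0 : ℝ) (α/2))
    (hκ : κ ∈ Set.Ioc (0 : ℝ) 1) (hP : 1 ≤ P) :
    volume {h : ℝ × ℝ × ℝ × ℝ |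
        h.1 ∈ Set.Ioc (1 : ℝ) 2 ∧ h.2.1 ∈ Set.Ioc (1 : ℝ) 2 ∧
        h.2.2.1 ∈ Set.Ioc (1 : ℝ) 2 ∧ h.2.2.2 ∈ Set.Ioc (1 : ℝ) 2 ∧
        ∃ q0 q0' q1 q1' : ℤ,
          |(q0 : ℝ)| ≤ P ^ ((α/2 - ε)/2) ∧ |(q0' : ℝ)| ≤ P ^ ((α/2 - ε)/2) ∧
          |(q1 : ℝ)| ≤ 2 * P ^ ((α/2 - ε)/2) ∧ |(q1' : ℝ)| ≤ 2 * P ^ ((α/2 - ε)/2) ∧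
          (q0, q1) ≠ (q0', q1') ∧
          |P ^ ((1 - α)/2) * h.1 * ((q0 : ℝ) - (q0' : ℝ)) +
              h.2.1 * ((q1 : ℝ) - (q1' : ℝ))| < κ * P ^ (-(3*α/2 - 1)/2)} ≤
      ENNReal.ofReal (64 * κ * P ^ (-ε/2)) := by
  obtain ⟨hα1, hα2⟩ := hα
  obtain ⟨hε1, hε2⟩ := hε
  obtain ⟨hκ1, hκ2⟩ := hκ
  have hP0 : 0 < P := by linarith
  have hA : 1 ≤ P ^ ((1 - α) / 2) := Real.one_le_rpow hP (by linarith)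
  have hQ : 1 ≤ P ^ ((α / 2 - ε) / 2) := Real.one_le_rpow hP (by linarith)
  have hδ0 : 0 < κ * P ^ (-(3 * α / 2 - 1) / 2) := by positivity
  have hδ1 : κ * P ^ (-(3 * α / 2 - 1) / 2) ≤ 1 :=
    mul_le_one₀ hκ2 (by positivity) (Real.rpow_le_one_of_one_le_of_nonpos hP (by linarith))
  have hprod : P ^ ((α / 2 - ε) / 2) * (κ * P ^ (-(3 * α / 2 - 1) / 2)) =
      κ * P ^ (-ε / 2) * P ^ ((1 - α) / 2) := by
    rw [mul_left_comm, ← Real.rpow_add hP0, mul_assoc, ← Real.rpow_add hP0]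
    ring_nf
  have hR : 0 < κ * P ^ (-ε / 2) := by positivity
  rw [mul_assoc 64 κ]
  generalize P ^ ((1 - α) / 2) = A at *
  generalize P ^ ((α / 2 - ε) / 2) = Q at *
  generalize κ * P ^ (-(3 * α / 2 - 1) / 2) = δ at *
  generalize κ * P ^ (-ε / 2) = R at *
  have hA0 : 0 < A := by linarith
  let S : ℕ → ℕ → Set (ℝ × ℝ × ℝ × ℝ) := fun n m =>
    {h | h.2 ∈ Ioc (1 : ℝ) 2 ×ˢ Ioc (1 : ℝ) 2 ×ˢ Ioc (1 : ℝ) 2 ∧ |A * n * h.1 - m * h.2.1| < δ}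
  calc _ ≤ volume (⋃ n ∈ Finset.Icc 1 ⌊9 * Q / A⌋₊, ⋃ m ∈ Finset.Icc 1 ⌊3 * (A * n)⌋₊, S n m) := by
        refine measure_mono ?_
        rintro ⟨x, y, z, w⟩ ⟨hx, hy, hz, hw, q0, q0', q1, q1', -, -, h1, h1', hne, hlt⟩
        simp only at hx hy hz hw hlt
        have hne' : q0 - q0' ≠ 0 ∨ q1 - q1' ≠ 0 := by
          by_contra! hcon
          exact hne (by ext <;> simp <;> omega)
        have hAx : 1 < A * x := by nlinarith [hx.1]
        rw [← Int.cast_sub, ← Int.cast_sub] at hlt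
        obtain ⟨hn, hm, heq⟩ :=
          natAbs_pos_and_abs_sub_natAbs_eq hAx hy.1 hne' (hlt.trans_le hδ1)
        rw [← heq] at hlt
        have hm4 : (((q1 - q1').natAbs : ℕ) : ℝ) ≤ 4 * Q := by
          rw [Nat.cast_natAbs, Int.cast_abs, Int.cast_sub]
          exact (abs_sub _ _).trans (by linarith)
        generalize (q0 - q0').natAbs = n at *
        generalize (q1 - q1').natAbs = m at *
        have hn1 : (1 : ℝ) ≤ n := by exact_mod_cast hn
        have hm1 : (1 : ℝ) ≤ m := by exact_mod_cast hm
        have hAn : 1 ≤ A * n := one_le_mul_of_one_le_of_one_le hA hn1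
        obtain ⟨hl, hu⟩ := abs_lt.1 hlt
        simp only [mem_iUnion, Finset.mem_Icc, exists_prop]
        refine ⟨n, ⟨hn, Nat.le_floor ?_⟩, m, ⟨hm, Nat.le_floor ?_⟩, ⟨hy, hz, hw⟩, ?_⟩
        · rw [le_div_iff₀ hA0]
          nlinarith [hx.1, hy.2]
        · nlinarith [hx.2, hy.1]
        · rwa [mul_right_comm, mul_comm (m : ℝ)]
    _ ≤ ∑ n ∈ Finset.Icc 1 ⌊9 * Q / A⌋₊, ∑ m ∈ Finset.Icc 1 ⌊3 * (A * n)⌋₊, volume (S n m) :=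
        (measure_biUnion_finset_le _ _).trans
          (Finset.sum_le_sum fun n _ => measure_biUnion_finset_le _ _)
    _ ≤ ∑ n ∈ Finset.Icc 1 ⌊9 * Q / A⌋₊, ENNReal.ofReal (6 * δ) := by
        refine Finset.sum_le_sum fun n hn => ?_
        have hn1 : (1 : ℝ) ≤ n := by exact_mod_cast (Finset.mem_Icc.1 hn).1
        have hAn : 0 < A * n := by positivity
        calc _ ≤ ∑ m ∈ Finset.Icc 1 ⌊3 * (A * n)⌋₊, ENNReal.ofReal (2 * δ / (A * n)) :=
              Finset.sum_le_sum fun m _ => volume_cube_slab_le _ _ _ hAn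
          _ = ENNReal.ofReal (⌊3 * (A * n)⌋₊ * (2 * δ / (A * n))) := by
              rw [Finset.sum_const, Nat.card_Icc, Nat.add_sub_cancel, ← ENNReal.ofReal_nsmul,
                nsmul_eq_mul]
          _ ≤ ENNReal.ofReal (6 * δ) := by
              refine ENNReal.ofReal_le_ofReal ?_
              calc _ ≤ 3 * (A * n) * (2 * δ / (A * n)) := by
                    gcongr
                    exact Nat.floor_le (by positivity)
                _ = 6 * δ := by
                    field_simp
                    norm_num
    _ = ENNReal.ofReal (⌊9 * Q / A⌋₊ * (6 * δ)) := by
        rw [Finset.sum_const, Nat.card_Icc, Nat.add_sub_cancel, ← ENNReal.ofReal_nsmul,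
          nsmul_eq_mul]
    _ ≤ ENNReal.ofReal (64 * R) := by
        refine ENNReal.ofReal_le_ofReal ?_
        calc _ ≤ 9 * Q / A * (6 * δ) := by
              gcongr
              exact Nat.floor_le (by positivity)
          _ = 54 * (Q * δ) / A := by ring
          _ = 54 * R := by
              rw [hprod]
              field_simp
          _ ≤ 64 * R := by linarith
end

section
/- Let α ∈ [0, 2/3], let B satisfy 0 ≤ B ≤ max{2α−1, 0}, let ε > 0, let κ ∈ (0, 1/2], let η ∈ [1,2), and let P ≥ 1 be a real number. Then the Lebesgue measure in ℝ⁴ of the set of quadruples (h11,h12,h21,h22) ∈ (1,2]⁴ for which there exist integers q0, q0' with |q0|, |q0'| ≤ P^{(B−ε)/2} and integers q1, q1' with |q1|, |q1'| ≤ P^{(1−α−B−ε)/2} such that (q0,q1) ≠ (q0',q1') and |P^{(2α−1−B+ε)/2}·η·(h12·h21/h22)·(q0−q0') + P^{(B+ε)/2}·(h11/2)·(q1−q1')| < κ·P^{ε/2} is at most 3584·κ·P^{−ε/2}. -/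
open MeasureTheory Set

/-- The affine slab `|f y + d x| < δ` over a base set `T` has measure at most its width times the
measure of `T`. -/
lemma volume_affine_slab_le {β : Type*} [MeasureSpace β] [SFinite (volume : Measure β)]
    {T : Set β} (hT : MeasurableSet T) {f : β → ℝ} (hf : Measurable f) {d : ℝ} (hd : d ≠ 0)
    (δ : ℝ) :
    volume {h : ℝ × β | h.2 ∈ T ∧ |f h.2 + d * h.1| < δ} ≤
      ENNReal.ofReal (2 * (δ / |d|)) * volume T := by
  have hd' : 0 < |d| := abs_pos.mpr hd
  have hm : MeasurableSet {h : ℝ × β | h.2 ∈ T ∧ |f h.2 + d * h.1| < δ} := by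
    have hfd : Measurable fun h : ℝ × β => |f h.2 + d * h.1| := by fun_prop
    exact (measurable_snd hT).inter (measurableSet_lt hfd measurable_const)
  rw [Measure.volume_eq_prod, Measure.prod_apply_symm hm]
  calc _ ≤ ∫⁻ y, T.indicator (fun _ => ENNReal.ofReal (2 * (δ / |d|))) y := by
        refine lintegral_mono fun y => ?_
        by_cases hy : y ∈ T
        · rw [indicator_of_mem hy, ← Real.volume_ball (-(f y) / d) (δ / |d|)]
          refine measure_mono fun x hx => ?_
          have e : (x - -(f y) / d) * d = f y + d * x := by
            field_simp
            ring
          rw [Metric.mem_ball, Real.dist_eq, lt_div_iff₀ hd', ← abs_mul, e]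
          exact hx.2
        · rw [indicator_of_notMem hy]
          refine (measure_mono_null (t := ∅) (fun x hx => hy hx.1) measure_empty).le
    _ = _ := by rw [lintegral_indicator_const hT]

/-- The number of nonzero integers of absolute value at most `X` is at most `2 X`. -/
lemma card_nonzero_Icc_floor_le {X : ℝ} (hX : 0 ≤ X) :
    ((((Finset.Icc (-⌊X⌋) ⌊X⌋).erase 0).card : ℕ) : ℝ) ≤ 2 * X := by
  have h0 : 0 ≤ ⌊X⌋ := Int.floor_nonneg.mpr hX
  have h1 := Int.floor_le X
  rw [Finset.card_erase_of_mem (by simp [h0]), Int.card_Icc]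
  have h2 : (((⌊X⌋ + 1 - -⌊X⌋).toNat - 1 : ℕ) : ℤ) = 2 * ⌊X⌋ := by omega
  have h3 : (((⌊X⌋ + 1 - -⌊X⌋).toNat - 1 : ℕ) : ℝ) = 2 * ⌊X⌋ := by exact_mod_cast h2
  rw [h3]
  linarith

lemma mem_nonzero_Icc_floor {X : ℝ} {a : ℤ} (ha : a ≠ 0) (haX : |(a : ℝ)| ≤ X) :
    a ∈ (Finset.Icc (-⌊X⌋) ⌊X⌋).erase 0 := by
  obtain ⟨h1, h2⟩ := abs_le.mp haX
  refine Finset.mem_erase.mpr ⟨ha, Finset.mem_Icc.mpr ⟨?_, Int.le_floor.mpr h2⟩⟩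
  have : -a ≤ ⌊X⌋ := Int.le_floor.mpr (by push_cast; linarith)
  omega

lemma sum_ofReal_const_le {ι : Type*} (s : Finset ι) {f : ι → ENNReal} {c k : ℝ}
    (hk : 0 ≤ k) (hs : (s.card : ℝ) ≤ k) (hf : ∀ i ∈ s, f i ≤ ENNReal.ofReal c) :
    ∑ i ∈ s, f i ≤ ENNReal.ofReal (k * c) := by
  calc ∑ i ∈ s, f i ≤ s.card • ENNReal.ofReal c := Finset.sum_le_card_nsmul _ _ _ hf
    _ = ENNReal.ofReal s.card * ENNReal.ofReal c := by
        rw [nsmul_eq_mul, ENNReal.ofReal_natCast]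
    _ ≤ ENNReal.ofReal k * ENNReal.ofReal c := by gcongr
    _ = _ := (ENNReal.ofReal_mul hk).symm

lemma mul_div_mem_Ioo {x y z : ℝ} (hx : x ∈ Ioc (1 : ℝ) 2) (hy : y ∈ Ioc (1 : ℝ) 2)
    (hz : z ∈ Ioc (1 : ℝ) 2) : x * y / z ∈ Ioo (1 / 2 : ℝ) 4 := by
  obtain ⟨hx1, hx2⟩ := hx
  obtain ⟨hy1, hy2⟩ := hy
  obtain ⟨hz1, hz2⟩ := hz
  have hz0 : 0 < z := by linarith
  constructor
  · rw [lt_div_iff₀ hz0]; nlinarith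
  · rw [div_lt_iff₀ hz0]; nlinarith

/-- Two terms that nearly cancel have comparable magnitudes. -/
lemma abs_le_of_near_cancellation {A C δ g x u v : ℝ} (hA : 0 < A) (hC : 0 < C)
    (hδA : 2 * δ ≤ A) (hδC : 2 * δ ≤ C) (hg : g ∈ Ioo (1 / 2 : ℝ) 4) (hx : x ∈ Ioc (1 : ℝ) 2)
    (hu : 1 ≤ |u|) (hv : 1 ≤ |v|) (h : |A * g * u + C * (x / 2) * v| < δ) :
    |v| ≤ 9 * (A * |u|) / C ∧ A * |u| ≤ 3 * (C * |v|) := by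
  obtain ⟨hg1, hg2⟩ := hg
  obtain ⟨hx1, hx2⟩ := hx
  have e1 : |A * g * u| = g * (A * |u|) := by
    rw [abs_mul, abs_mul, abs_of_pos hA, abs_of_pos (by linarith : (0 : ℝ) < g)]; ring
  have e2 : |C * (x / 2) * v| = x / 2 * (C * |v|) := by
    rw [abs_mul, abs_mul, abs_of_pos hC, abs_of_pos (by linarith : (0 : ℝ) < x / 2)]; ring
  have t1 := abs_sub_abs_le_abs_sub (A * g * u) (-(C * (x / 2) * v))
  have t2 := abs_sub_abs_le_abs_sub (C * (x / 2) * v) (-(A * g * u))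
  rw [abs_neg, sub_neg_eq_add, e1, e2] at t1 t2
  rw [add_comm (C * (x / 2) * v)] at t2
  have p1 : A ≤ A * |u| := le_mul_of_one_le_right hA.le hu
  have p2 : C ≤ C * |v| := le_mul_of_one_le_right hC.le hv
  constructor
  · rw [le_div_iff₀ hC]; nlinarith
  · nlinarith

/-- Measure of the coefficients for which some nonzero pair of integer differences, the first
of which is bounded by `X`, yields a near cancellation. -/
lemma volume_near_cancellation_le {A C δ X : ℝ} (hA : 0 < A) (hC : 0 < C)
    (hδA : 2 * δ ≤ A) (hδC : 2 * δ ≤ C) (hδ : 0 < δ) (hX : 0 ≤ X) :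
    volume {h : ℝ × ℝ × ℝ × ℝ |
        h.1 ∈ Ioc (1 : ℝ) 2 ∧ h.2 ∈ Ioc (1 : ℝ) 2 ×ˢ Ioc (1 : ℝ) 2 ×ˢ Ioc (1 : ℝ) 2 ∧
        ∃ a b : ℤ, a ≠ 0 ∧ b ≠ 0 ∧ |(a : ℝ)| ≤ X ∧
          |A * (h.2.1 * h.2.2.1 / h.2.2.2) * a + C * (h.1 / 2) * b| < δ} ≤
      ENNReal.ofReal (432 * (X * δ / C)) := by
  set T : Set (ℝ × ℝ × ℝ) := Ioc (1 : ℝ) 2 ×ˢ Ioc (1 : ℝ) 2 ×ˢ Ioc (1 : ℝ) 2 with hTdef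
  have hTm : MeasurableSet T :=
    measurableSet_Ioc.prod (measurableSet_Ioc.prod measurableSet_Ioc)
  have hTv : volume T = 1 := by
    rw [hTdef, Measure.volume_eq_prod, Measure.prod_prod, Measure.volume_eq_prod,
      Measure.prod_prod, Real.volume_Ioc]
    norm_num
  let N : ℝ → Finset ℤ := fun Y => (Finset.Icc (-⌊Y⌋) ⌊Y⌋).erase 0
  let E : ℤ → ℤ → Set (ℝ × ℝ × ℝ × ℝ) := fun a b => {h | A * |(a : ℝ)| ≤ 3 * (C * |(b : ℝ)|) ∧
    h.2 ∈ T ∧ |A * (h.2.1 * h.2.2.1 / h.2.2.2) * a + C / 2 * b * h.1| < δ}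
  have one_le {n : ℤ} (hn : n ≠ 0) : 1 ≤ |(n : ℝ)| := by
    exact_mod_cast Int.one_le_abs hn
  have hE {a b : ℤ} (ha : a ≠ 0) (hb : b ≠ 0) :
      volume (E a b) ≤ ENNReal.ofReal (12 * (δ / (A * |(a : ℝ)|))) := by
    have ha' := one_le ha
    have hb' := one_le hb
    by_cases hab : A * |(a : ℝ)| ≤ 3 * (C * |(b : ℝ)|)
    · have hd : C / 2 * (b : ℝ) ≠ 0 := by
        have : (b : ℝ) ≠ 0 := by exact_mod_cast hb
        positivity
      have hf : Measurable fun y : ℝ × ℝ × ℝ => A * (y.1 * y.2.1 / y.2.2) * a := by fun_prop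
      calc volume (E a b) ≤ _ :=
            (measure_mono fun h hh => hh.2).trans (volume_affine_slab_le hTm hf hd δ)
        _ ≤ _ := by
          rw [hTv, mul_one]
          refine ENNReal.ofReal_le_ofReal ?_
          rw [abs_mul, abs_of_pos (half_pos hC)]
          have h1 : 0 < A * |(a : ℝ)| := by positivity
          have h2 : 0 < C / 2 * |(b : ℝ)| := by positivity
          rw [← mul_div_assoc, ← mul_div_assoc, div_le_div_iff₀ h2 h1]
          nlinarith
    · exact (measure_mono_null (t := ∅) (fun h hh => hab hh.1) measure_empty).le.trans zero_le
  have hsub : {h : ℝ × ℝ × ℝ × ℝ | h.1 ∈ Ioc (1 : ℝ) 2 ∧ h.2 ∈ T ∧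
        ∃ a b : ℤ, a ≠ 0 ∧ b ≠ 0 ∧ |(a : ℝ)| ≤ X ∧
          |A * (h.2.1 * h.2.2.1 / h.2.2.2) * a + C * (h.1 / 2) * b| < δ} ⊆
      ⋃ a ∈ N X, ⋃ b ∈ N (9 * (A * |(a : ℝ)|) / C), E a b := by
    rintro h ⟨hh1, hh2, a, b, ha, hb, haX, hlt⟩
    obtain ⟨hbN, hab⟩ := abs_le_of_near_cancellation hA hC hδA hδC
      (mul_div_mem_Ioo hh2.1 hh2.2.1 hh2.2.2) hh1 (one_le ha) (one_le hb) hlt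
    refine mem_biUnion (mem_nonzero_Icc_floor ha haX)
      (mem_biUnion (mem_nonzero_Icc_floor hb hbN) ⟨hab, hh2, ?_⟩)
    convert hlt using 3
    ring
  have hfib (a : ℤ) (ha : a ∈ N X) :
      volume (⋃ b ∈ N (9 * (A * |(a : ℝ)|) / C), E a b) ≤ ENNReal.ofReal (216 * (δ / C)) := by
    have ha0 : a ≠ 0 := Finset.ne_of_mem_erase ha
    have ha' := one_le ha0
    have hY : 0 ≤ 9 * (A * |(a : ℝ)|) / C := by positivity
    refine (measure_biUnion_finset_le _ _).trans
      ((sum_ofReal_const_le _ (by positivity) (card_nonzero_Icc_floor_le hY)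
        fun b hb => hE ha0 (Finset.ne_of_mem_erase hb)).trans_eq ?_)
    congr 1
    have : |(a : ℝ)| ≠ 0 := by positivity
    field_simp
    norm_num
  refine (measure_mono hsub).trans ((measure_biUnion_finset_le _ _).trans
    ((sum_ofReal_const_le _ (by positivity) (card_nonzero_Icc_floor_le hX) hfib).trans_eq ?_))
  congr 1
  ring

/-- outage-set measure bound for the MAC-WT decoding step in the regime
0 ≤ α ≤ 2/3, 0 ≤ B ≤ (2α−1)⁺. -/
theorem macwt_min_distance_outage_measure_low_alpha
    (α B ε κ η P : ℝ) (hα0 : 0 ≤ α) (hα : α ≤ 2/3)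
    (hB0 : 0 ≤ B) (hB : B ≤ max (2*α - 1) 0)
    (hε : 0 < ε) (hκ : κ ∈ Set.Ioc (0 : ℝ) (1/2)) (hη : η ∈ Set.Ico (1 : ℝ) 2)
    (hP : 1 ≤ P) :
    volume {h : ℝ × ℝ × ℝ × ℝ |
        h.1 ∈ Set.Ioc (1 : ℝ) 2 ∧ h.2.1 ∈ Set.Ioc (1 : ℝ) 2 ∧
        h.2.2.1 ∈ Set.Ioc (1 : ℝ) 2 ∧ h.2.2.2 ∈ Set.Ioc (1 : ℝ) 2 ∧
        ∃ q0 q0' q1 q1' : ℤ,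
          |(q0 : ℝ)| ≤ P ^ ((B - ε)/2) ∧ |(q0' : ℝ)| ≤ P ^ ((B - ε)/2) ∧
          |(q1 : ℝ)| ≤ P ^ ((1 - α - B - ε)/2) ∧ |(q1' : ℝ)| ≤ P ^ ((1 - α - B - ε)/2) ∧
          (q0, q1) ≠ (q0', q1') ∧
          |P ^ ((2*α - 1 - B + ε)/2) * η * (h.2.1 * h.2.2.1 / h.2.2.2) *
              ((q0 : ℝ) - (q0' : ℝ)) +
            P ^ ((B + ε)/2) * (h.1 / 2) * ((q1 : ℝ) - (q1' : ℝ))| < κ * P ^ (ε/2)} ≤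
      ENNReal.ofReal (3584 * κ * P ^ (-ε/2)) := by
  obtain ⟨hκ0, hκ1⟩ := hκ
  have hP0 : 0 < P := by linarith
  have hQε : 0 < P ^ (ε / 2) := Real.rpow_pos_of_pos hP0 _
  have hCge : P ^ (ε / 2) ≤ P ^ ((B + ε) / 2) :=
    Real.rpow_le_rpow_of_exponent_le hP (by linarith)
  have hexp (q : ℤ) (hq : q ≠ 0) (h : |(q : ℝ)| ≤ P ^ ((B - ε) / 2)) :
      P ^ (ε / 2) ≤ P ^ ((2 * α - 1 - B + ε) / 2) := by
    have h1 : (1 : ℝ) ≤ P ^ ((B - ε) / 2) :=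
      le_trans (by exact_mod_cast Int.one_le_abs hq) h
    rcases hP.eq_or_lt with rfl | hP1
    · simp
    · have hB' : ε ≤ B := by
        by_contra! hlt
        exact absurd (Real.rpow_lt_one_of_one_lt_of_neg hP1 (by linarith)) h1.not_gt
      have : B ≤ 2 * α - 1 := (le_max_iff.mp hB).resolve_right (by linarith)
      exact Real.rpow_le_rpow_of_exponent_le hP (by linarith)
  have hκε : 2 * (κ * P ^ (ε / 2)) ≤ P ^ (ε / 2) := by nlinarith
  have hb0 {x : ℝ} (hx : x ∈ Ioc (1 : ℝ) 2) {b : ℤ} (hb : b ≠ 0) :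
      κ * P ^ (ε / 2) ≤ |P ^ ((B + ε) / 2) * (x / 2) * b| := by
    have h1 : (1 : ℝ) ≤ |(b : ℝ)| := by exact_mod_cast Int.one_le_abs hb
    rw [abs_mul, abs_of_pos (mul_pos (hQε.trans_le hCge) (by linarith [hx.1]))]
    have h2 : P ^ ((B + ε) / 2) * (1 / 2) ≤ P ^ ((B + ε) / 2) * (x / 2) := by
      gcongr; exact hx.1.le
    nlinarith
  by_cases hAge : P ^ (ε / 2) ≤ P ^ ((2 * α - 1 - B + ε) / 2)
  · have hAη : P ^ (ε / 2) ≤ P ^ ((2 * α - 1 - B + ε) / 2) * η :=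
      hAge.trans (le_mul_of_one_le_right (hQε.trans_le hAge).le hη.1)
    have key := volume_near_cancellation_le (hQε.trans_le hAη) (hQε.trans_le hCge)
      (hκε.trans hAη) (hκε.trans hCge) (by positivity)
      (by positivity : 0 ≤ 2 * P ^ ((B - ε) / 2))
    refine (measure_mono ?_).trans (key.trans (ENNReal.ofReal_le_ofReal ?_))
    · rintro h ⟨h1, h2, h3, h4, q0, q0', q1, q1', hq0, hq0', -, -, hne, hlt⟩
      refine ⟨h1, ⟨h2, h3, h4⟩, q0 - q0', q1 - q1', ?_, ?_, ?_, by push_cast; exact hlt⟩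
      · intro ha
        have hb : q1 - q1' ≠ 0 := fun hb =>
          hne (Prod.ext (sub_eq_zero.mp ha) (sub_eq_zero.mp hb))
        have ha' : (q0 : ℝ) - q0' = 0 := by exact_mod_cast ha
        rw [ha', mul_zero, zero_add] at hlt
        have := hb0 h1 hb
        push_cast at this
        linarith
      · intro hb
        have ha : q0 - q0' ≠ 0 := fun ha =>
          hne (Prod.ext (sub_eq_zero.mp ha) (sub_eq_zero.mp hb))
        have ha' : (1 : ℝ) ≤ |(q0 : ℝ) - q0'| := by exact_mod_cast Int.one_le_abs ha
        have hb' : (q1 : ℝ) - q1' = 0 := by exact_mod_cast hb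
        have hg := (mul_div_mem_Ioo h2 h3 h4).1
        rw [hb', mul_zero, add_zero, abs_mul,
          abs_of_pos (mul_pos (hQε.trans_le hAη) (by linarith))] at hlt
        have := mul_le_mul hAη hg.le (by norm_num) (hQε.trans_le hAη).le
        nlinarith
      · push_cast
        linarith [abs_sub (q0 : ℝ) q0']
    · have e : P ^ ((B - ε) / 2) * P ^ (ε / 2) / P ^ ((B + ε) / 2) = P ^ (-ε / 2) := by
        rw [← Real.rpow_add hP0, ← Real.rpow_sub hP0]
        congr 1
        ring
      have hpos : 0 < P ^ (-ε / 2) := Real.rpow_pos_of_pos hP0 _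
      calc _ = 864 * κ * (P ^ ((B - ε) / 2) * P ^ (ε / 2) / P ^ ((B + ε) / 2)) := by ring
        _ ≤ _ := by rw [e]; gcongr; norm_num
  · refine (measure_mono_null (t := ∅) ?_ measure_empty).le.trans zero_le
    rintro h ⟨h1, -, -, -, q0, q0', q1, q1', hq0, hq0', -, -, hne, hlt⟩
    have z0 : q0 = 0 := by_contra fun hq => hAge (hexp q0 hq hq0)
    have z0' : q0' = 0 := by_contra fun hq => hAge (hexp q0' hq hq0')
    subst z0 z0'
    have hb : q1 - q1' ≠ 0 := fun hb => hne (Prod.ext rfl (sub_eq_zero.mp hb))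
    have := hb0 h1 hb
    push_cast at this
    rw [sub_self, mul_zero, zero_add] at hlt
    linarith
end

section
/- Let d1, d2 be reals with d1 ≥ 0, d2 ≥ 0 and d1 + d2 ≤ 1, let ε > 0, let κ ∈ (0, 1/2], let η1, η2 ∈ [1,2), and let P ≥ 1 be a real number. Then the Lebesgue measure in ℝ⁴ of the set of quadruples (h11,h12,h21,h22) ∈ (1,2]⁴ for which there exist integers q0, q0' with |q0|, |q0'| ≤ P^{(d1−ε)/2} and integers q1, q1' with |q1|, |q1'| ≤ P^{(d2−ε)/2} such that (q0,q1) ≠ (q0',q1') and |P^{(1−d1+ε)/2}·η1·h11·(q0−q0') + P^{(1−d2+ε)/2}·η2·(h12·h21/h22)·(q1−q1')| < κ·P^{ε/2} is at most 1792·κ·P^{−ε/2}. -/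
open MeasureTheory Set

/-- The set of points whose first coordinate lies in a window of half-width `δ / |a|` around a
measurable function of the second coordinate, over a base `E`. -/
lemma volume_abs_affine_lt_le {α : Type*} [MeasureSpace α] [SFinite (volume : Measure α)]
    {E : Set α} (hE : MeasurableSet E) {f : α → ℝ} (hf : Measurable f) {a : ℝ} (ha : a ≠ 0)
    (δ : ℝ) :
    volume {p : ℝ × α | p.2 ∈ E ∧ |a * p.1 + f p.2| < δ} ≤
      ENNReal.ofReal (2 * δ / |a|) * volume E := by
  have hmeas : MeasurableSet {p : ℝ × α | p.2 ∈ E ∧ |a * p.1 + f p.2| < δ} := by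
    have hlt : MeasurableSet {p : ℝ × α | |a * p.1 + f p.2| < δ} :=
      measurableSet_lt (by fun_prop) measurable_const
    exact (measurable_snd hE).inter hlt
  rw [Measure.volume_eq_prod, Measure.prod_apply_symm hmeas, ← lintegral_indicator_const hE]
  refine lintegral_mono fun y => ?_
  by_cases hy : y ∈ E
  · have hsub : (fun x => (x, y)) ⁻¹' {p : ℝ × α | p.2 ∈ E ∧ |a * p.1 + f p.2| < δ} ⊆
        Metric.ball (-f y / a) (δ / |a|) := by
      rintro x ⟨-, hx⟩
      rw [Metric.mem_ball, Real.dist_eq, lt_div_iff₀ (abs_pos.2 ha), ← abs_mul]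
      have hxa : (x - -f y / a) * a = a * x + f y := by
        field_simp
        ring
      rwa [hxa]
    calc _ ≤ volume (Metric.ball (-f y / a) (δ / |a|)) := measure_mono hsub
      _ = _ := by rw [Real.volume_ball, indicator_of_mem hy, mul_div_assoc]
  · have : (fun x => (x, y)) ⁻¹' {p : ℝ × α | p.2 ∈ E ∧ |a * p.1 + f p.2| < δ} = ∅ := by
      ext x
      simp [hy]
    simp [this]

/-- The nonzero integers of absolute value at most `X`. -/
noncomputable def nonzeroIntsUpTo (X : ℝ) : Finset ℤ := (Finset.Icc (-⌊X⌋) ⌊X⌋).erase 0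

lemma mem_nonzeroIntsUpTo {X : ℝ} {n : ℤ} :
    n ∈ nonzeroIntsUpTo X ↔ n ≠ 0 ∧ |(n : ℝ)| ≤ X := by
  rw [nonzeroIntsUpTo, Finset.mem_erase, Finset.mem_Icc, ← abs_le, Int.le_floor, Int.cast_abs]

lemma card_nonzeroIntsUpTo_le {X : ℝ} (hX : 0 ≤ X) : ((nonzeroIntsUpTo X).card : ℝ) ≤ 2 * X := by
  have h0 : 0 ≤ ⌊X⌋ := Int.floor_nonneg.2 hX
  have hcard : ((nonzeroIntsUpTo X).card : ℤ) = 2 * ⌊X⌋ := by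
    rw [nonzeroIntsUpTo, Finset.card_erase_of_mem (by simp [h0]), Int.card_Icc]
    omega
  have : ((nonzeroIntsUpTo X).card : ℝ) = 2 * (⌊X⌋ : ℝ) := by exact_mod_cast hcard
  rw [this]
  linarith [Int.floor_le X]

lemma half_lt_mul_div_of_mem_Ioc {x y z : ℝ} (hx : x ∈ Ioc (1 : ℝ) 2) (hy : y ∈ Ioc (1 : ℝ) 2)
    (hz : z ∈ Ioc (1 : ℝ) 2) : 1 / 2 < x * y / z := by
  obtain ⟨hx1, hx2⟩ := hx
  obtain ⟨hy1, hy2⟩ := hy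
  obtain ⟨hz1, hz2⟩ := hz
  rw [lt_div_iff₀ (by linarith)]
  nlinarith

lemma one_le_abs_intCast {n : ℤ} (hn : n ≠ 0) : (1 : ℝ) ≤ |(n : ℝ)| := by
  exact_mod_cast Int.one_le_abs hn

/-- If two nonzero multiples nearly cancel, then both coefficients are nonzero and the second one
is controlled by the first one. -/
lemma coeff_bound_of_abs_add_lt {A B δ x g : ℝ} {m n : ℤ} (hA : 2 * δ ≤ A) (hB : 2 * δ ≤ B)
    (hδ : 0 < δ) (hx : x ∈ Ioc (1 : ℝ) 2) (hg : 1 / 2 < g) (hmn : ¬(m = 0 ∧ n = 0))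
    (h : |A * x * m + B * g * n| < δ) : m ≠ 0 ∧ n ≠ 0 ∧ |(n : ℝ)| ≤ 5 * A * |(m : ℝ)| / B := by
  obtain ⟨hx1, hx2⟩ := hx
  have hA0 : 0 < A := by linarith
  have hB0 : 0 < B := by linarith
  have hAx : |A * x * m| = A * x * |(m : ℝ)| := by
    rw [abs_mul, abs_of_pos (by positivity)]
  have hBg : |B * g * n| = B * g * |(n : ℝ)| := by
    rw [abs_mul, abs_of_pos (mul_pos hB0 (by linarith))]
  have hm : m ≠ 0 := by
    rintro rfl
    have hn1 := one_le_abs_intCast (n := n) (by tauto)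
    simp only [Int.cast_zero, mul_zero, zero_add, hBg] at h
    nlinarith [mul_pos hB0 (sub_pos.2 hg), mul_nonneg (mul_pos hB0 (by linarith : 0 < g)).le
      (sub_nonneg.2 hn1)]
  have hm1 := one_le_abs_intCast hm
  have hAm : A ≤ A * |(m : ℝ)| := le_mul_of_one_le_right hA0.le hm1
  refine ⟨hm, ?_, ?_⟩
  · rintro rfl
    simp only [Int.cast_zero, mul_zero, add_zero, hAx] at h
    nlinarith
  · rw [le_div_iff₀ hB0]
    have h1 : |B * g * n| ≤ |A * x * m + B * g * n| + |A * x * m| := by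
      simpa using abs_sub (A * x * m + B * g * n) (A * x * m)
    rw [hAx, hBg] at h1
    have h2 : B * |(n : ℝ)| * (1 / 2) ≤ B * |(n : ℝ)| * g := by gcongr
    have h3 : A * |(m : ℝ)| * x ≤ A * |(m : ℝ)| * 2 := by gcongr
    linarith

/-- outage-set measure bound for the MAC-WT scheme at α = 1 targeting
the secure GDoF pair (d1, d2). -/
theorem macwt_alpha_one_outage_measure
    (d1 d2 ε κ η1 η2 P : ℝ) (hd1 : 0 ≤ d1) (hd2 : 0 ≤ d2) (hd : d1 + d2 ≤ 1)
    (hε : 0 < ε) (hκ : κ ∈ Set.Ioc (0 : ℝ) (1/2))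
    (hη1 : η1 ∈ Set.Ico (1 : ℝ) 2) (hη2 : η2 ∈ Set.Ico (1 : ℝ) 2) (hP : 1 ≤ P) :
    volume {h : ℝ × ℝ × ℝ × ℝ |
        h.1 ∈ Set.Ioc (1 : ℝ) 2 ∧ h.2.1 ∈ Set.Ioc (1 : ℝ) 2 ∧
        h.2.2.1 ∈ Set.Ioc (1 : ℝ) 2 ∧ h.2.2.2 ∈ Set.Ioc (1 : ℝ) 2 ∧
        ∃ q0 q0' q1 q1' : ℤ,
          |(q0 : ℝ)| ≤ P ^ ((d1 - ε)/2) ∧ |(q0' : ℝ)| ≤ P ^ ((d1 - ε)/2) ∧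
          |(q1 : ℝ)| ≤ P ^ ((d2 - ε)/2) ∧ |(q1' : ℝ)| ≤ P ^ ((d2 - ε)/2) ∧
          (q0, q1) ≠ (q0', q1') ∧
          |P ^ ((1 - d1 + ε)/2) * η1 * h.1 * ((q0 : ℝ) - (q0' : ℝ)) +
            P ^ ((1 - d2 + ε)/2) * η2 * (h.2.1 * h.2.2.1 / h.2.2.2) *
              ((q1 : ℝ) - (q1' : ℝ))| < κ * P ^ (ε/2)} ≤
      ENNReal.ofReal (1792 * κ * P ^ (-ε/2)) := by
  obtain ⟨hκ0, hκ1⟩ := hκ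
  have hP0 : 0 < P := by linarith
  set A := P ^ ((1 - d1 + ε)/2) * η1 with hA
  set B := P ^ ((1 - d2 + ε)/2) * η2 with hB
  set δ := κ * P ^ (ε/2) with hδ
  set Q := P ^ ((d1 - ε)/2) with hQ
  have hδ0 : 0 < δ := by positivity
  have hQ0 : 0 < Q := by positivity
  have hscale : ∀ d η : ℝ, d ≤ 1 → 1 ≤ η → 2 * δ ≤ P ^ ((1 - d + ε)/2) * η := by
    intro d η hd hη
    have h1 : P ^ (ε/2) ≤ P ^ ((1 - d + ε)/2) :=
      Real.rpow_le_rpow_of_exponent_le hP (by linarith)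
    have h2 : 0 < P ^ (ε/2) := by positivity
    nlinarith
  have hAδ : 2 * δ ≤ A := hscale d1 η1 (by linarith) hη1.1
  have hBδ : 2 * δ ≤ B := hscale d2 η2 (by linarith) hη2.1
  have hA0 : 0 < A := by linarith
  have hB0 : 0 < B := by linarith
  set E : Set (ℝ × ℝ × ℝ) := Ioc (1 : ℝ) 2 ×ˢ Ioc (1 : ℝ) 2 ×ˢ Ioc (1 : ℝ) 2 with hE
  have hEmeas : MeasurableSet E :=
    measurableSet_Ioc.prod (measurableSet_Ioc.prod measurableSet_Ioc)
  have hEvol : volume E = 1 := by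
    rw [hE, Measure.volume_eq_prod, Measure.prod_prod, Measure.volume_eq_prod, Measure.prod_prod,
      Real.volume_Ioc]
    norm_num
  let T : ℤ → ℤ → Set (ℝ × ℝ × ℝ × ℝ) := fun m n =>
    {p | p.2 ∈ E ∧ |A * m * p.1 + B * (p.2.1 * p.2.2.1 / p.2.2.2) * n| < δ}
  have hT : ∀ m n : ℤ, m ≠ 0 → volume (T m n) ≤ ENNReal.ofReal (2 * δ / (A * |(m : ℝ)|)) := by
    intro m n hm
    have hm' : (m : ℝ) ≠ 0 := by exact_mod_cast hm
    have h := volume_abs_affine_lt_le hEmeas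
      (f := fun y : ℝ × ℝ × ℝ => B * (y.1 * y.2.1 / y.2.2) * n) (by fun_prop)
      (mul_ne_zero hA0.ne' hm') δ
    rwa [hEvol, mul_one, abs_mul, abs_of_pos hA0] at h
  have hcover : {h : ℝ × ℝ × ℝ × ℝ |
        h.1 ∈ Set.Ioc (1 : ℝ) 2 ∧ h.2.1 ∈ Set.Ioc (1 : ℝ) 2 ∧
        h.2.2.1 ∈ Set.Ioc (1 : ℝ) 2 ∧ h.2.2.2 ∈ Set.Ioc (1 : ℝ) 2 ∧
        ∃ q0 q0' q1 q1' : ℤ,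
          |(q0 : ℝ)| ≤ Q ∧ |(q0' : ℝ)| ≤ Q ∧
          |(q1 : ℝ)| ≤ P ^ ((d2 - ε)/2) ∧ |(q1' : ℝ)| ≤ P ^ ((d2 - ε)/2) ∧
          (q0, q1) ≠ (q0', q1') ∧
          |A * h.1 * ((q0 : ℝ) - (q0' : ℝ)) +
            B * (h.2.1 * h.2.2.1 / h.2.2.2) * ((q1 : ℝ) - (q1' : ℝ))| < δ} ⊆
      ⋃ m ∈ nonzeroIntsUpTo (2 * Q), ⋃ n ∈ nonzeroIntsUpTo (5 * A * |(m : ℝ)| / B), T m n := by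
    rintro ⟨x, y, z, w⟩ ⟨hx, hy, hz, hw, q0, q0', q1, q1', h0, h0', -, -, hne, hlt⟩
    rw [← Int.cast_sub, ← Int.cast_sub] at hlt
    obtain ⟨hm, hn, hnm⟩ := coeff_bound_of_abs_add_lt hAδ hBδ hδ0 hx
      (half_lt_mul_div_of_mem_Ioc hy hz hw)
      (fun h => hne (Prod.ext (sub_eq_zero.1 h.1) (sub_eq_zero.1 h.2))) hlt
    have hmQ : |((q0 - q0' : ℤ) : ℝ)| ≤ 2 * Q := by
      rw [Int.cast_sub]
      linarith [abs_sub (q0 : ℝ) q0']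
    simp only [mem_iUnion, exists_prop]
    refine ⟨q0 - q0', mem_nonzeroIntsUpTo.2 ⟨hm, hmQ⟩, q1 - q1', mem_nonzeroIntsUpTo.2 ⟨hn, hnm⟩,
      ⟨hy, hz, hw⟩, ?_⟩
    rwa [mul_right_comm A]
  have hinner : ∀ m ∈ nonzeroIntsUpTo (2 * Q),
      ∑ n ∈ nonzeroIntsUpTo (5 * A * |(m : ℝ)| / B), volume (T m n) ≤
        ENNReal.ofReal (20 * δ / B) := by
    intro m hm
    have hm0 := (mem_nonzeroIntsUpTo.1 hm).1
    have hm1 : 0 < |(m : ℝ)| := by linarith [one_le_abs_intCast hm0]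
    refine (Finset.sum_le_card_nsmul _ _ _ fun n _ => hT m n hm0).trans ?_
    rw [← ENNReal.ofReal_nsmul, nsmul_eq_mul]
    refine ENNReal.ofReal_le_ofReal ?_
    calc _ ≤ 2 * (5 * A * |(m : ℝ)| / B) * (2 * δ / (A * |(m : ℝ)|)) := by
          gcongr
          exact card_nonzeroIntsUpTo_le (by positivity)
      _ = 20 * δ / B := by
          field_simp
          ring
  have hfinal : 2 * (2 * Q) * (20 * δ / B) ≤ 1792 * κ * P ^ (-ε/2) := by
    rw [← mul_div_assoc, div_le_iff₀ hB0]
    have hpow : Q * P ^ (ε/2) ≤ P ^ (-ε/2) * P ^ ((1 - d2 + ε)/2) := by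
      rw [hQ, ← Real.rpow_add hP0, ← Real.rpow_add hP0]
      exact Real.rpow_le_rpow_of_exponent_le hP (by linarith)
    have hB1 : P ^ ((1 - d2 + ε)/2) ≤ B :=
      le_mul_of_one_le_right (by positivity) hη2.1
    have hle : Q * P ^ (ε/2) ≤ P ^ (-ε/2) * B := hpow.trans (by gcongr)
    have hpos : 0 ≤ κ * (P ^ (-ε/2) * B) := by positivity
    calc _ = 80 * (κ * (Q * P ^ (ε/2))) := by rw [hδ]; ring
      _ ≤ 80 * (κ * (P ^ (-ε/2) * B)) := by gcongr
      _ ≤ 1792 * κ * P ^ (-ε/2) * B := by linarith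
  calc _ ≤ _ := measure_mono hcover
    _ ≤ ∑ m ∈ nonzeroIntsUpTo (2 * Q), ∑ n ∈ nonzeroIntsUpTo (5 * A * |(m : ℝ)| / B),
          volume (T m n) :=
        (measure_biUnion_finset_le _ _).trans
          (Finset.sum_le_sum fun m _ => measure_biUnion_finset_le _ _)
    _ ≤ (nonzeroIntsUpTo (2 * Q)).card • ENNReal.ofReal (20 * δ / B) :=
        Finset.sum_le_card_nsmul _ _ _ hinner
    _ ≤ ENNReal.ofReal (1792 * κ * P ^ (-ε/2)) := by
        rw [← ENNReal.ofReal_nsmul, nsmul_eq_mul]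
        refine ENNReal.ofReal_le_ofReal (le_trans ?_ hfinal)
        gcongr
        exact card_nonzeroIntsUpTo_le (by positivity)
end

section
/- Fix reals h' > 0, g_max > 0, σ > 0, γ' > 0 and exponents α1, α2, α' with α1 > α2 > 0 and 0 < α' < α1 − α2, all independent of P. For each real P ≥ 1 set Q(P) := P^{α'/2}·h'·γ'/(2·g_max), ξ(P) := γ'/Q(P), and Ω_P := {ξ(P)·a : a ∈ ℤ, |a| ≤ Q(P)}. Suppose on a probability space x' is a random variable with values in Ω_P, g' is a random variable with |g'| ≤ g_max almost surely, and z' is a random variable whose law is the Gaussian distribution with mean 0 and variance σ², and set y' := P^{α1/2}·h'·x' + P^{α2/2}·g' + z'. Then for any random variable x̂ taking values in Ω_P and satisfying |y' − P^{α1/2}·h'·x̂| = min over x ∈ Ω_P of |y' − P^{α1/2}·h'·x| almost surely, the probability Pr(x̂ ≠ x') tends to 0 as P → ∞. -/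
open MeasureTheory ProbabilityTheory Filter Set

/-- The tails of a finite measure on `ℝ` vanish at infinity. -/
lemma tendsto_measure_le_abs_atTop (ν : Measure ℝ) [IsFiniteMeasure ν] :
    Tendsto (fun M : ℝ => ν {x | M ≤ |x|}) atTop (nhds 0) := by
  have h := tendsto_measure_iInter_atTop (μ := ν) (s := fun M : ℝ => {x : ℝ | M ≤ |x|})
    (fun M => (measurableSet_le measurable_const measurable_id.abs).nullMeasurableSet)
    (fun _ _ hab _ hx => hab.trans hx) ⟨0, measure_ne_top _ _⟩
  have he : ⋂ M : ℝ, {x : ℝ | M ≤ |x|} = ∅ := by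
    refine eq_empty_of_forall_notMem fun x hx => ?_
    have := mem_iInter.1 hx (|x| + 1)
    simp only [mem_ofPred_eq] at this
    linarith
  rwa [he, measure_empty] at h

/-- The gap between two different real powers tends to infinity. -/
lemma tendsto_rpow_sub_rpow_atTop {a b : ℝ} (hb : 0 < b) (hab : b < a) :
    Tendsto (fun P : ℝ => P ^ a - P ^ b) atTop atTop := by
  have h1 : Tendsto (fun P : ℝ => P ^ b * (P ^ (a - b) + -1)) atTop atTop :=
    (tendsto_rpow_atTop hb).atTop_mul_atTop₀
      (tendsto_atTop_add_const_right _ _ (tendsto_rpow_atTop (sub_pos.2 hab)))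
  refine h1.congr' ?_
  filter_upwards [eventually_gt_atTop 0] with P hP
  have : P ^ a = P ^ b * P ^ (a - b) := by
    rw [← Real.rpow_add hP]; congr 1; ring
  rw [this]; ring

/-- If scaled lattice points `c * m` and `c * n` are distinct and `c * n` is at least as close to
the observation `c * m + w` as `c * m` is, then the perturbation `w` is at least `c / 2`. -/
lemma half_spacing_le_abs_of_ne {c w : ℝ} (hc : 0 ≤ c) {m n : ℤ} (hmn : n ≠ m)
    (hmin : |c * m + w - c * n| ≤ |w|) : c / 2 ≤ |w| := by
  have h1 : (1 : ℝ) ≤ |(m : ℝ) - n| := by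
    exact_mod_cast Int.one_le_abs (sub_ne_zero.2 hmn.symm)
  have h2 : |c * ((m : ℝ) - n)| ≤ |c * m + w - c * n| + |w| := by
    have h := abs_sub (c * m + w - c * n) w
    rwa [show c * m + w - c * n - w = c * ((m : ℝ) - n) by ring] at h
  rw [abs_mul, abs_of_nonneg hc] at h2
  nlinarith

/-- the minimum-distance estimate of a PAM symbol from a noisy observation
with bounded interference and Gaussian noise is correct with probability tending to 1
as the power parameter P grows. -/
theorem pam_decoding_error_vanishes
    (h' gmax σ γ' α1 α2 α' : ℝ)
    (hh' : 0 < h') (hgmax : 0 < gmax) (hσ : 0 < σ) (hγ' : 0 < γ')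
    (hα2 : 0 < α2) (hα12 : α2 < α1) (hα'0 : 0 < α') (hα' : α' < α1 - α2)
    {Ω : Type*} [MeasurableSpace Ω] (μ : Measure Ω) [IsProbabilityMeasure μ]
    (x' g' z' xest : ℝ → Ω → ℝ)
    -- the PAM constellation Ω_P for each power level P
    (Q : ℝ → ℝ) (ξ : ℝ → ℝ) (C : ℝ → Set ℝ)
    (hQ : ∀ P, Q P = P ^ (α'/2) * h' * γ' / (2 * gmax))
    (hξ : ∀ P, ξ P = γ' / Q P)
    (hC : ∀ P, C P = {x : ℝ | ∃ a : ℤ, |(a : ℝ)| ≤ Q P ∧ x = ξ P * (a : ℝ)})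
    -- x', g', z', xest are random variables
    (hx'meas : ∀ P, Measurable (x' P)) (hg'meas : ∀ P, Measurable (g' P))
    (hz'meas : ∀ P, Measurable (z' P)) (hxestmeas : ∀ P, Measurable (xest P))
    -- hypotheses for every power level P ≥ 1
    (hx'val : ∀ P, 1 ≤ P → ∀ ω, x' P ω ∈ C P)
    (hg'bd : ∀ P, 1 ≤ P → ∀ᵐ ω ∂μ, |g' P ω| ≤ gmax)
    (hz'law : ∀ P, 1 ≤ P → μ.map (z' P) = gaussianReal 0 ⟨σ^2, sq_nonneg σ⟩)
    (hxestval : ∀ P, 1 ≤ P → ∀ ω, xest P ω ∈ C P)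
    -- xest is a minimum-distance estimate of x' from y'
    (hxestmin : ∀ P, 1 ≤ P → ∀ᵐ ω ∂μ, ∀ x ∈ C P,
      |(P ^ (α1/2) * h' * x' P ω + P ^ (α2/2) * g' P ω + z' P ω) - P ^ (α1/2) * h' * xest P ω| ≤
      |(P ^ (α1/2) * h' * x' P ω + P ^ (α2/2) * g' P ω + z' P ω) - P ^ (α1/2) * h' * x|) :
    Tendsto (fun P : ℝ => μ {ω | xest P ω ≠ x' P ω}) atTop (nhds 0) := by
  have hprob : IsProbabilityMeasure (gaussianReal 0 ⟨σ ^ 2, sq_nonneg σ⟩) :=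
    hz'law 1 le_rfl ▸ Measure.isProbabilityMeasure_map (hz'meas 1).aemeasurable
  have hgap : Tendsto (fun P : ℝ => gmax * (P ^ ((α1 - α') / 2) - P ^ (α2 / 2))) atTop atTop :=
    (tendsto_rpow_sub_rpow_atTop (by linarith) (by linarith)).const_mul_atTop hgmax
  refine tendsto_of_tendsto_of_tendsto_of_le_of_le' tendsto_const_nhds
    ((tendsto_measure_le_abs_atTop (gaussianReal 0 ⟨σ ^ 2, sq_nonneg σ⟩)).comp hgap)
    (Eventually.of_forall fun _ => zero_le) ?_
  filter_upwards [eventually_ge_atTop 1] with P hP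
  have hP0 : 0 < P := by linarith
  rw [Function.comp_apply, ← hz'law P hP, Measure.map_apply (hz'meas P)
    (measurableSet_le measurable_const continuous_abs.measurable)]
  refine measure_mono_ae ?_
  filter_upwards [hg'bd P hP, hxestmin P hP] with ω hg hmin hne
  obtain ⟨m, -, hm⟩ := (hC P ▸ hx'val P hP ω : x' P ω ∈ {x : ℝ | _})
  obtain ⟨n, -, hn⟩ := (hC P ▸ hxestval P hP ω : xest P ω ∈ {x : ℝ | _})
  have hspacing : P ^ (α1 / 2) * h' * ξ P = 2 * (gmax * P ^ ((α1 - α') / 2)) := by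
    have hpow : P ^ (α1 / 2) = P ^ ((α1 - α') / 2) * P ^ (α' / 2) := by
      rw [← Real.rpow_add hP0]; congr 1; ring
    have := (Real.rpow_pos_of_pos hP0 (α' / 2)).ne'
    rw [hξ, hQ, hpow]
    field_simp
  have hnm : n ≠ m := by
    rintro rfl
    exact hne (hn.trans hm.symm)
  have hle := hmin _ (hx'val P hP ω)
  rw [hm, hn] at hle
  have hhalf := half_spacing_le_abs_of_ne (c := P ^ (α1 / 2) * h' * ξ P)
    (w := P ^ (α2 / 2) * g' P ω + z' P ω) (by rw [hspacing]; positivity) hnm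
    (by convert hle using 2 <;> ring)
  have hpow0 : 0 < P ^ (α2 / 2) := Real.rpow_pos_of_pos hP0 _
  have htri := abs_add_le (P ^ (α2 / 2) * g' P ω) (z' P ω)
  rw [abs_mul, abs_of_pos hpow0] at htri
  have hint := mul_le_mul_of_nonneg_left hg hpow0.le
  change gmax * (P ^ ((α1 - α') / 2) - P ^ (α2 / 2)) ≤ |z' P ω|
  linarith
end
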